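/- arXiv:0706.1973 — 2 statements merged into one kernel-verified Lean document; each statement's English description precedes it below -/
import Mathlib

section
/- The quadruple (A1, A2, A3, A4) is a 4-(109; 54, 45, 51, 57; 98) supplementary difference set in Z_109; that is, |A1| = 54, |A2| = 45, |A3| = 51, |A4| = 57, and for every nonzero d ∈ Z_109, the total number of ordered pairs (x, y) with x, y ∈ A_i and x − y = d, summed over i = 1, 2, 3, 4, equals 98. -/
open Finset Matrix

/-- The subgroup H of order 3 of the multiplicative group of `ZMod 109`. -/
def H : Finset (ZMod 109) := {1, 45, 63}

/-- Representatives of the even-indexed orbits. -/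
def rep : List (ZMod 109) := [1, 2, 3, 4, 5, 6, 8, 9, 10, 11, 13, 15, 16, 18, 20, 23, 25, 30]

/-- The orbits `α i`: `α (2*i) = rep[i] • H` and `α (2*i+1) = -α (2*i)`. -/
def alpha (i : ℕ) : Finset (ZMod 109) :=
  if i % 2 = 0 then H.image (fun h => rep.getD (i / 2) 0 * h)
  else (H.image (fun h => rep.getD (i / 2) 0 * h)).image (fun x => -x)

def A1 : Finset (ZMod 109) := ({0, 2, 5, 7, 8, 10, 12, 15, 16, 19, 20, 23, 24, 26, 29, 30, 33, 34} : Finset ℕ).biUnion alpha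
def A2 : Finset (ZMod 109) := ({4, 5, 6, 7, 11, 15, 18, 19, 20, 22, 25, 30, 32, 33, 35} : Finset ℕ).biUnion alpha
def A3 : Finset (ZMod 109) := ({0, 1, 5, 6, 9, 10, 11, 14, 17, 20, 24, 26, 27, 28, 29, 31, 32} : Finset ℕ).biUnion alpha
def A4 : Finset (ZMod 109) := ({0, 3, 4, 6, 7, 9, 10, 12, 13, 22, 24, 25, 26, 27, 28, 29, 31, 33, 35} : Finset ℕ).biUnion alpha

/-- The number of ordered pairs of elements of `S` with difference `d` is the number of `y ∈ S`
whose translate `y + d` also lies in `S`. -/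
theorem card_filter_sub_eq {G : Type*} [AddCommGroup G] [DecidableEq G] (S : Finset G) (d : G) :
    ((S ×ˢ S).filter (fun p => p.1 - p.2 = d)).card = (S.filter (fun y => y + d ∈ S)).card := by
  refine Finset.card_bij' (fun p _ => p.2) (fun y _ => (y + d, y)) ?_ ?_ ?_ ?_
  · rintro ⟨x, y⟩ h
    simp only [mem_filter, mem_product] at h ⊢
    obtain ⟨⟨hx, hy⟩, rfl⟩ := h
    exact ⟨hy, by simpa using hx⟩
  · intro y h
    simp only [mem_filter, mem_product] at h ⊢
    exact ⟨⟨h.2, h.1⟩, by simp⟩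
  · rintro ⟨x, y⟩ h
    simp only [mem_filter] at h
    simp [← h.2]
  · simp

/-- The subset of `ZMod 109` whose indicator function is given by the binary digits of `m`. -/
def ofMask (m : ℕ) : Finset (ZMod 109) := univ.filter (fun x => m.testBit x.val)

theorem card_filter_sub_eq_ofMask (m : ℕ) (d : ZMod 109) :
    ((ofMask m ×ˢ ofMask m).filter (fun p => p.1 - p.2 = d)).card =
      (univ.filter (fun y : ZMod 109 => m.testBit y.val ∧ m.testBit (y + d).val)).card := by
  rw [card_filter_sub_eq]
  simp only [ofMask, filter_filter, mem_filter, mem_univ, true_and]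

theorem A1_eq_ofMask : A1 = ofMask 123459675551352000816092535023078 := by
  decide +kernel

theorem A2_eq_ofMask : A2 = ofMask 133430319674679116411051224115224 := by
  decide +kernel

theorem A3_eq_ofMask : A3 = ofMask 441819033027258125526959733944914 := by
  decide +kernel

theorem A4_eq_ofMask : A4 = ofMask 230730465453557616443923388797274 := by
  decide +kernel

theorem sds_A :
    A1.card = 54 ∧ A2.card = 45 ∧ A3.card = 51 ∧ A4.card = 57 ∧
    ∀ d : ZMod 109, d ≠ 0 →
      ((A1 ×ˢ A1).filter (fun p => p.1 - p.2 = d)).card +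
      ((A2 ×ˢ A2).filter (fun p => p.1 - p.2 = d)).card +
      ((A3 ×ˢ A3).filter (fun p => p.1 - p.2 = d)).card +
      ((A4 ×ˢ A4).filter (fun p => p.1 - p.2 = d)).card = 98 := by
  rw [A1_eq_ofMask, A2_eq_ofMask, A3_eq_ofMask, A4_eq_ofMask]
  simp only [card_filter_sub_eq_ofMask]
  decide +kernel
end

section
/- There exists a skew-Hadamard matrix of order 436; that is, there exists a 436 × 436 integer matrix M with all entries ±1 such that M · Mᵀ = 436 · I_436 and M + Mᵀ = 2 · I_436. -/
open Matrix

section GoethalsSeidel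

variable {G : Type*} [AddCommGroup G]

/-- The Goethals–Seidel array with first row of blocks `A, BR, CR, DR`, where `A, B, C, D` are the
group-developed matrices of `a, b, c, d` and `R` is the permutation matrix of `x ↦ -x`. -/
def goethalsSeidel (a b c d : G → ℤ) : Matrix (Fin 4 × G) (Fin 4 × G) ℤ :=
  fun p q =>
    (!![a (q.2 - p.2), b (-p.2 - q.2), c (-p.2 - q.2), d (-p.2 - q.2);
        -b (-p.2 - q.2), a (q.2 - p.2), d (p.2 + q.2), -c (p.2 + q.2);
        -c (-p.2 - q.2), -d (p.2 + q.2), a (q.2 - p.2), b (p.2 + q.2);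
        -d (-p.2 - q.2), c (p.2 + q.2), -b (p.2 + q.2), a (q.2 - p.2)] :
      Matrix (Fin 4) (Fin 4) ℤ) p.1 q.1

theorem goethalsSeidel_eq_one_or_neg_one {a b c d : G → ℤ}
    (ha : ∀ x, a x = 1 ∨ a x = -1) (hb : ∀ x, b x = 1 ∨ b x = -1)
    (hc : ∀ x, c x = 1 ∨ c x = -1) (hd : ∀ x, d x = 1 ∨ d x = -1) (p q : Fin 4 × G) :
    goethalsSeidel a b c d p q = 1 ∨ goethalsSeidel a b c d p q = -1 := by
  obtain ⟨i, x⟩ := p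
  obtain ⟨j, y⟩ := q
  have hneg : ∀ {z : ℤ}, z = 1 ∨ z = -1 → -z = 1 ∨ -z = -1 := by omega
  fin_cases i <;> fin_cases j <;>
    first
    | exact ha _ | exact hb _ | exact hc _ | exact hd _
    | exact hneg (hb _) | exact hneg (hc _) | exact hneg (hd _)

theorem goethalsSeidel_add_transpose [DecidableEq G] {a : G → ℤ} (b c d : G → ℤ)
    (ha : ∀ x, a x + a (-x) = if x = 0 then 2 else 0) :
    goethalsSeidel a b c d + (goethalsSeidel a b c d)ᵀ = (2 : ℤ) • 1 := by
  have key : ∀ x y : G, a (y - x) + a (x - y) = if x = y then 2 else 0 := by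
    intro x y
    rw [← neg_sub y x, ha]
    simp [sub_eq_zero, eq_comm]
  ext ⟨i, x⟩ ⟨j, y⟩
  fin_cases i <;> fin_cases j <;>
    simp [goethalsSeidel, Matrix.one_apply, key, add_comm y x, neg_sub_comm y x]

variable [Fintype G]

/-- The periodic autocorrelation function. -/
def autocorrelation (f : G → ℤ) (s : G) : ℤ :=
  ∑ x, f x * f (x + s)

theorem sum_sub_mul_sub (f : G → ℤ) (x x' : G) :
    ∑ y, f (y - x) * f (y - x') = autocorrelation f (x - x') := by
  rw [← Equiv.sum_comp (Equiv.addRight x), autocorrelation]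
  refine Finset.sum_congr rfl fun y _ => ?_
  congr 2 <;> simp only [Equiv.coe_addRight] <;> abel

theorem sum_add_mul_add (f : G → ℤ) (x x' : G) :
    ∑ y, f (x + y) * f (x' + y) = autocorrelation f (x - x') := by
  rw [← Equiv.sum_comp (Equiv.subRight x'), autocorrelation]
  refine Finset.sum_congr rfl fun y _ => ?_
  rw [mul_comm]
  congr 2 <;> simp only [Equiv.subRight_apply] <;> abel

theorem sum_neg_sub_mul_neg_sub (f : G → ℤ) (x x' : G) :
    ∑ y, f (-x - y) * f (-x' - y) = autocorrelation f (x - x') := by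
  rw [← Equiv.sum_comp (Equiv.subLeft (-x)), autocorrelation]
  refine Finset.sum_congr rfl fun y _ => ?_
  congr 2 <;> simp only [Equiv.subLeft_apply] <;> abel

theorem sum_sub_mul_neg_sub_comm (f g : G → ℤ) (x x' : G) :
    ∑ y, f (y - x) * g (-x' - y) = ∑ y, g (-x - y) * f (y - x') := by
  rw [← Equiv.sum_comp (Equiv.addRight (x - x'))]
  refine Finset.sum_congr rfl fun y _ => ?_
  rw [mul_comm]
  congr 2 <;> simp only [Equiv.coe_addRight] <;> abel

theorem sum_sub_mul_add_comm (f g : G → ℤ) (x x' : G) :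
    ∑ y, f (y - x) * g (x' + y) = ∑ y, g (x + y) * f (y - x') := by
  rw [← Equiv.sum_comp (Equiv.addRight (x - x'))]
  refine Finset.sum_congr rfl fun y _ => ?_
  rw [mul_comm]
  congr 2 <;> simp only [Equiv.coe_addRight] <;> abel

theorem sum_neg_sub_mul_add_comm (f g : G → ℤ) (x x' : G) :
    ∑ y, f (-x - y) * g (x' + y) = ∑ y, g (-x - y) * f (x' + y) := by
  rw [← Equiv.sum_comp (Equiv.subLeft (-x - x'))]
  refine Finset.sum_congr rfl fun y _ => ?_
  rw [mul_comm]
  congr 2 <;> simp only [Equiv.subLeft_apply] <;> abel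

theorem sum_add_mul_neg_sub_comm (f g : G → ℤ) (x x' : G) :
    ∑ y, f (x + y) * g (-x' - y) = ∑ y, g (x + y) * f (-x' - y) := by
  simpa only [mul_comm] using sum_neg_sub_mul_add_comm g f x' x

theorem sum_neg_sub_mul_neg_sub_comm (f g : G → ℤ) (x x' : G) :
    ∑ y, f (-x - y) * g (-x' - y) = ∑ y, g (x + y) * f (x' + y) := by
  rw [← Equiv.sum_comp (Equiv.subLeft (-x - x'))]
  refine Finset.sum_congr rfl fun y _ => ?_
  rw [mul_comm]
  congr 2 <;> simp only [Equiv.subLeft_apply] <;> abel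

theorem goethalsSeidel_mul_transpose [DecidableEq G] {a b c d : G → ℤ} {m : ℤ}
    (h : ∀ s, autocorrelation a s + autocorrelation b s + autocorrelation c s +
      autocorrelation d s = if s = 0 then m else 0) :
    goethalsSeidel a b c d * (goethalsSeidel a b c d)ᵀ = m • 1 := by
  have key : ∀ x x' : G, autocorrelation a (x - x') + autocorrelation b (x - x') +
      autocorrelation c (x - x') + autocorrelation d (x - x') = if x = x' then m else 0 := by
    intro x x'
    simp [h, sub_eq_zero]
  ext ⟨i, x⟩ ⟨j, x'⟩
  have hx := key x x'
  rw [Matrix.mul_apply, Fintype.sum_prod_type, Fin.sum_univ_four]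
  have ab := sum_sub_mul_neg_sub_comm a b x x'
  have ac := sum_sub_mul_neg_sub_comm a c x x'
  have ad := sum_sub_mul_neg_sub_comm a d x x'
  have ab' := sum_sub_mul_add_comm a b x x'
  have ac' := sum_sub_mul_add_comm a c x x'
  have ad' := sum_sub_mul_add_comm a d x x'
  have bc := sum_neg_sub_mul_add_comm b c x x'
  have bd := sum_neg_sub_mul_add_comm b d x x'
  have cd := sum_neg_sub_mul_add_comm c d x x'
  have bc' := sum_add_mul_neg_sub_comm b c x x'
  have bd' := sum_add_mul_neg_sub_comm b d x x'
  have cd' := sum_add_mul_neg_sub_comm c d x x'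
  have bc₂ := sum_neg_sub_mul_neg_sub_comm b c x x'
  have bd₂ := sum_neg_sub_mul_neg_sub_comm b d x x'
  have cd₂ := sum_neg_sub_mul_neg_sub_comm c d x x'
  have cb₂ := sum_neg_sub_mul_neg_sub_comm c b x x'
  have db₂ := sum_neg_sub_mul_neg_sub_comm d b x x'
  have dc₂ := sum_neg_sub_mul_neg_sub_comm d c x x'
  fin_cases i <;> fin_cases j <;>
    simp [goethalsSeidel, Matrix.one_apply, sum_sub_mul_sub, sum_add_mul_add,
      sum_neg_sub_mul_neg_sub] <;>
    linarith

end GoethalsSeidel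

/-- The `±1` function on `ZMod 109` equal to `-1` exactly at the positions of the binary digits `1`
of `m`. -/
def signOfBits (m : ℕ) (x : ZMod 109) : ℤ :=
  bif m.testBit x.val then -1 else 1

theorem signOfBits_eq_one_or_neg_one (m : ℕ) (x : ZMod 109) :
    signOfBits m x = 1 ∨ signOfBits m x = -1 := by
  unfold signOfBits
  cases m.testBit x.val <;> simp

/-- The four base blocks of a supplementary difference family on `ZMod 109` with block sizes
54, 45, 51, 52, encoded in binary; the first one is of skew type. -/
def baseBlock : Fin 4 → ℕ :=
  ![0xdd538fc26f2f6a42c26f038d512,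
    0x10202c35548759024fac4e436e1c,
    0x97cb8f5764651840f20cd69f608,
    0x1838d7d3f59910994636c54a035d]

theorem signOfBits_baseBlock_zero_skew (x : ZMod 109) :
    signOfBits (baseBlock 0) x + signOfBits (baseBlock 0) (-x) = if x = 0 then 2 else 0 := by
  revert x
  decide +kernel

theorem sum_autocorrelation_baseBlock (s : ZMod 109) :
    autocorrelation (signOfBits (baseBlock 0)) s + autocorrelation (signOfBits (baseBlock 1)) s +
      autocorrelation (signOfBits (baseBlock 2)) s + autocorrelation (signOfBits (baseBlock 3)) s =
      if s = 0 then 436 else 0 := by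
  revert s
  decide +kernel

theorem exists_skew_hadamard_436 :
    ∃ M : Matrix (Fin 436) (Fin 436) ℤ,
      (∀ i j, M i j = 1 ∨ M i j = -1) ∧
      M * Mᵀ = (436 : ℤ) • 1 ∧
      M + Mᵀ = (2 : ℤ) • 1 := by
  let e : Fin 436 ≃ Fin 4 × ZMod 109 := (finProdFinEquiv (m := 4) (n := 109)).symm
  let N : Matrix (Fin 4 × ZMod 109) (Fin 4 × ZMod 109) ℤ :=
    goethalsSeidel (signOfBits (baseBlock 0)) (signOfBits (baseBlock 1))
      (signOfBits (baseBlock 2)) (signOfBits (baseBlock 3))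
  have hmul : N * Nᵀ = (436 : ℤ) • 1 := goethalsSeidel_mul_transpose sum_autocorrelation_baseBlock
  have hadd : N + Nᵀ = (2 : ℤ) • 1 :=
    goethalsSeidel_add_transpose _ _ _ signOfBits_baseBlock_zero_skew
  refine ⟨N.submatrix e e, fun i j => ?_, ?_, ?_⟩
  · exact goethalsSeidel_eq_one_or_neg_one (signOfBits_eq_one_or_neg_one _)
      (signOfBits_eq_one_or_neg_one _) (signOfBits_eq_one_or_neg_one _)
      (signOfBits_eq_one_or_neg_one _) _ _
  · rw [Matrix.transpose_submatrix, Matrix.submatrix_mul_equiv, hmul, Matrix.submatrix_smul,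
      Pi.smul_apply, Pi.smul_apply, Matrix.submatrix_one_equiv]
  · rw [Matrix.transpose_submatrix, ← Pi.add_apply, ← Pi.add_apply, ← Matrix.submatrix_add, hadd,
      Matrix.submatrix_smul, Pi.smul_apply, Pi.smul_apply, Matrix.submatrix_one_equiv]
end
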